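/- arXiv:1901.07118 — 5 statements merged into one kernel-verified Lean document; each statement's English description precedes it below -/
import Mathlib

section
/- Let R be a commutative ring, V a finite type with decidable equality, and f, g : Finset V → R. Then the zeta transform of the union product of f and g equals the pointwise product of the zeta transforms: for every X : Finset V, ζ(f *_u g)[X] = (ζf)[X] · (ζg)[X]. -/
/-- The union product `(f *_u g)[X] = ∑_{X₁ ∪ X₂ = X} f[X₁] · g[X₂]`, summing over
ordered pairs of subsets of `X` whose union is `X`. -/
def unionProd {R : Type*} [CommRing R] {V : Type*} [DecidableEq V]
    (f g : Finset V → R) (X : Finset V) : R :=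
  ∑ p ∈ (X.powerset ×ˢ X.powerset).filter (fun p => p.1 ∪ p.2 = X), f p.1 * g p.2

/-- The zeta transform of a union product is the pointwise product of the zeta transforms. -/
theorem zeta_unionProd {R : Type*} [CommRing R] {V : Type*} [Fintype V] [DecidableEq V]
    (f g : Finset V → R) (X : Finset V) :
    ∑ Y ∈ X.powerset, unionProd f g Y =
      (∑ Y ∈ X.powerset, f Y) * (∑ Y ∈ X.powerset, g Y) := by
  rw [Finset.sum_mul_sum, ← Finset.sum_product',
    ← Finset.sum_fiberwise_of_maps_to (s := X.powerset ×ˢ X.powerset) (t := X.powerset)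
      (g := fun p => p.1 ∪ p.2)]
  · refine Finset.sum_congr rfl fun Y hY => ?_
    rw [Finset.mem_powerset] at hY
    unfold unionProd
    refine Finset.sum_congr ?_ fun _ _ => rfl
    ext p
    simp only [Finset.mem_filter, Finset.mem_product, Finset.mem_powerset]
    constructor
    · rintro ⟨⟨h1, h2⟩, h⟩
      exact ⟨⟨h1.trans hY, h2.trans hY⟩, h⟩
    · rintro ⟨_, h⟩
      exact ⟨⟨h ▸ Finset.subset_union_left, h ▸ Finset.subset_union_right⟩, h⟩
  · intro p hp
    simp only [Finset.mem_product, Finset.mem_powerset] at hp ⊢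
    exact Finset.union_subset hp.1 hp.2
end

section
/- Let R be a commutative ring, V a finite type with decidable equality, and f, g : Finset V → R with relaxations {f^i} and {g^i} respectively (for 0 ≤ i ≤ |V|). Define h^i[X] = ∑_{j=0}^{i} (f^j *_u g^{i-j})[X]. Then {h^i} is a relaxation of the subset convolution f *_R g; in particular, for every X : Finset V, h^{|X|}[X] = (f *_R g)[X], and h^i[X] = 0 whenever i < |X|. -/
/-- The subset convolution `(f *_R g)[X] = ∑_{X₁ ⊆ X} f[X₁] · g[X \ X₁]`. -/
def subsetConv {R : Type*} [CommRing R] {V : Type*} [DecidableEq V]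
    (f g : Finset V → R) (X : Finset V) : R :=
  ∑ Y ∈ X.powerset, f Y * g (X \ Y)

/-- If `{f^i}` and `{g^i}` are relaxations of `f` and `g`, then
`h^i[X] = ∑_{j=0}^{i} (f^j *_u g^{i-j})[X]` is a relaxation of the subset convolution
`f *_R g`: it equals `(f *_R g)[X]` when `i = |X|` and vanishes when `i < |X|`. -/
theorem relaxation_of_subsetConv {R : Type*} [CommRing R] {V : Type*} [Fintype V] [DecidableEq V]
    (f g : Finset V → R) (fi gi : ℕ → Finset V → R)
    (hf₀ : ∀ i (X : Finset V), i < X.card → fi i X = 0)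
    (hf₁ : ∀ X : Finset V, fi X.card X = f X)
    (hg₀ : ∀ i (X : Finset V), i < X.card → gi i X = 0)
    (hg₁ : ∀ X : Finset V, gi X.card X = g X) :
    (∀ X : Finset V,
      ∑ j ∈ Finset.range (X.card + 1), unionProd (fi j) (gi (X.card - j)) X
        = subsetConv f g X) ∧
    (∀ i (X : Finset V), i < X.card →
      ∑ j ∈ Finset.range (i + 1), unionProd (fi j) (gi (i - j)) X = 0) := by
  constructor
  · intro X
    unfold unionProd subsetConv
    rw [Finset.sum_comm]
    have himg : ∑ Y ∈ X.powerset, f Y * g (X \ Y)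
        = ∑ p ∈ X.powerset.image (fun Y => (Y, X \ Y)), f p.1 * g p.2 := by
      rw [Finset.sum_image]
      intro a _ b _ h
      exact (Prod.mk.inj h).1
    rw [himg]
    symm
    apply Finset.sum_subset_zero_on_sdiff
    · intro p hp
      simp only [Finset.mem_image, Finset.mem_powerset] at hp
      obtain ⟨Y, hY, rfl⟩ := hp
      simp [hY, Finset.union_sdiff_of_subset hY]
    · rintro ⟨A, B⟩ hp
      simp only [Finset.mem_sdiff, Finset.mem_filter, Finset.mem_product, Finset.mem_powerset,
        Finset.mem_image, Prod.mk.injEq, not_exists, not_and] at hp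
      obtain ⟨⟨⟨hA, hB⟩, hU⟩, hn⟩ := hp
      have hlt : X.card < A.card + B.card := by
        by_contra hle
        have h1 := Finset.card_union_add_card_inter A B
        rw [hU] at h1
        have h2 : (A ∩ B).card = 0 := by omega
        rw [Finset.card_eq_zero] at h2
        apply hn A hA rfl
        rw [← hU, Finset.union_sdiff_left, Finset.sdiff_eq_self_iff_disjoint,
          disjoint_comm, Finset.disjoint_iff_inter_eq_empty]
        exact h2
      apply Finset.sum_eq_zero
      intro j _
      by_cases hj : j < A.card
      · simp [hf₀ j A hj]
      · have := Finset.card_le_card hB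
        have := Finset.card_le_card hA
        simp [hg₀ (X.card - j) B (by
          have : 0 < B.card := by omega
          omega)]
    · intro p hp
      simp only [Finset.mem_image, Finset.mem_powerset] at hp
      obtain ⟨Y, hY, rfl⟩ := hp
      have hc := Finset.card_sdiff_add_card_eq_card hY
      symm
      rw [Finset.sum_eq_single Y.card]
      · have : X.card - Y.card = (X \ Y).card := by omega
        simp only [this, hf₁, hg₁]
      · intro j hj hne
        rw [Finset.mem_range] at hj
        by_cases h : j < Y.card
        · simp [hf₀ j Y h]
        · simp only []
          rw [hg₀ (X.card - j) (X \ Y) (by omega), mul_zero]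
      · intro h
        exact absurd (Finset.mem_range.2 (by omega)) h
  · intro i X hi
    apply Finset.sum_eq_zero
    intro j hj
    rw [Finset.mem_range] at hj
    apply Finset.sum_eq_zero
    rintro ⟨A, B⟩ hp
    simp only [Finset.mem_filter] at hp
    have h1 := Finset.card_union_le A B
    rw [hp.2] at h1
    by_cases h : j < A.card
    · simp [hf₀ j A h]
    · simp [hg₀ (i - j) B (by omega)]
end

section
/- Let R be a commutative ring, V a finite type with decidable equality, and f, g : Finset V → R with relaxations {f^i} and {g^i}. Define h^i[X] = ∑_{j=0}^{i} (f^j *_u g^{i-j})[X]. Then for every i and every X : Finset V, the zeta transform satisfies (ζh^i)[X] = ∑_{j=0}^{i} (ζf^j)[X] · (ζg^{i-j})[X]. -/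
/-- If `{f^i}` and `{g^i}` are relaxations of `f` and `g`, and
`h^i[X] = ∑_{j=0}^{i} (f^j *_u g^{i-j})[X]`, then the zeta transform satisfies
`(ζ h^i)[X] = ∑_{j=0}^{i} (ζ f^j)[X] · (ζ g^{i-j})[X]`. -/
theorem zeta_relaxation_join {R : Type*} [CommRing R] {V : Type*} [Fintype V] [DecidableEq V]
    (f g : Finset V → R) (fi gi : ℕ → Finset V → R)
    (hf₀ : ∀ i (X : Finset V), i < X.card → fi i X = 0)
    (hf₁ : ∀ X : Finset V, fi X.card X = f X)
    (hg₀ : ∀ i (X : Finset V), i < X.card → gi i X = 0)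
    (hg₁ : ∀ X : Finset V, gi X.card X = g X) :
    ∀ (i : ℕ) (X : Finset V),
      ∑ Y ∈ X.powerset, (∑ j ∈ Finset.range (i + 1), unionProd (fi j) (gi (i - j)) Y)
        = ∑ j ∈ Finset.range (i + 1),
            (∑ Y ∈ X.powerset, fi j Y) * (∑ Y ∈ X.powerset, gi (i - j) Y) := by
  intro i X
  rw [Finset.sum_comm]
  refine Finset.sum_congr rfl fun j _ => ?_
  rw [Finset.sum_mul_sum, ← Finset.sum_product',
    ← Finset.sum_fiberwise_of_maps_to (s := X.powerset ×ˢ X.powerset) (t := X.powerset)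
      (g := fun p => p.1 ∪ p.2)]
  · refine Finset.sum_congr rfl fun Y hY => ?_
    unfold unionProd
    refine Finset.sum_congr ?_ fun _ _ => rfl
    ext p
    simp only [Finset.mem_filter, Finset.mem_product, Finset.mem_powerset] at hY ⊢
    constructor
    · rintro ⟨⟨h1, h2⟩, h3⟩
      exact ⟨⟨h1.trans hY, h2.trans hY⟩, h3⟩
    · rintro ⟨_, h3⟩
      exact ⟨⟨h3 ▸ Finset.subset_union_left, h3 ▸ Finset.subset_union_right⟩, h3⟩
  · intro p hp
    simp only [Finset.mem_product, Finset.mem_powerset] at hp ⊢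
    exact Finset.union_subset hp.1 hp.2
end

section
/- Let R be a commutative ring, V a finite type with decidable equality, and f, g : Finset V → R. For 0 ≤ j ≤ |V| define the ranked function f_j : Finset V → R by f_j[Y] = f[Y] if |Y| = j and f_j[Y] = 0 otherwise, and similarly g_j. Then for every X : Finset V, the subset convolution satisfies (f *_R g)[X] = ∑_{j=0}^{|X|} (f_j *_u g_{|X|-j})[X]. -/
/-- Expressing subset convolution by union products of the ranked functions:
`(f *_R g)[X] = ∑_{j=0}^{|X|} (f_j *_u g_{|X|−j})[X]`, where `f_j[Y] = f[Y]` if `|Y| = j`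
and `0` otherwise. -/
theorem subsetConv_eq_sum_unionProd_ranked {R : Type*} [CommRing R] {V : Type*}
    [Fintype V] [DecidableEq V] (f g : Finset V → R) (X : Finset V) :
    subsetConv f g X
      = ∑ j ∈ Finset.range (X.card + 1),
          unionProd (fun Y => if Y.card = j then f Y else 0)
            (fun Y => if Y.card = X.card - j then g Y else 0) X := by
  unfold subsetConv unionProd
  rw [Finset.sum_comm, Finset.sum_filter, Finset.sum_product]
  refine Finset.sum_congr rfl fun Y hY => ?_
  have hYX : Y ⊆ X := Finset.mem_powerset.1 hY
  have hle : Y.card ≤ X.card := Finset.card_le_card hYX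
  have inner : ∀ Z : Finset V, (∑ j ∈ Finset.range (X.card + 1),
      (if Y.card = j then f Y else 0) * (if Z.card = X.card - j then g Z else 0))
      = f Y * (if Z.card = X.card - Y.card then g Z else 0) := by
    intro Z
    rw [Finset.sum_eq_single Y.card]
    · simp
    · intro j _ hj
      rw [if_neg (Ne.symm hj), zero_mul]
    · intro h
      exact absurd (Finset.mem_range.2 (by omega)) h
  simp only [inner]
  rw [Finset.sum_eq_single (X \ Y)]
  · rw [if_pos (Finset.union_sdiff_of_subset hYX),
      if_pos (Finset.card_sdiff_of_subset hYX)]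
  · intro Z _ hne
    split_ifs with h1 h2
    · exfalso
      apply hne
      symm
      apply Finset.eq_of_subset_of_card_le
      · intro x hx
        rw [← h1] at hx
        simp only [Finset.mem_sdiff, Finset.mem_union] at hx
        tauto
      · rw [Finset.card_sdiff_of_subset hYX, h2]
    · simp
    · rfl
  · intro h
    exact absurd (Finset.mem_powerset.2 Finset.sdiff_subset) h
end

section
/- For any connected simple graph G on a finite nonempty vertex set of size n, the tree-depth td(G) and the treewidth tw(G) satisfy td(G) ≥ tw(G) + 1 and tw(G) + 1 ≥ td(G) / log₂(n) (for n ≥ 2). -/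
/-- A tree decomposition of a simple graph `G`: a finite tree `T` on a node type `ι`
with a bag `bag x ⊆ V` for each node, such that every vertex lies in some bag,
every edge of `G` is contained in some bag, and for any nodes `x, y` and any node `z`
on a path between `x` and `y` in `T`, `bag x ∩ bag y ⊆ bag z`. -/
structure TreeDecomp {V : Type} (G : SimpleGraph V) where
  ι : Type
  fintype_ι : Fintype ι
  T : SimpleGraph ι
  isTree : T.IsTree
  bag : ι → Set V
  vertexCover : ∀ v : V, ∃ x : ι, v ∈ bag x
  edgeCover : ∀ u v : V, G.Adj u v → ∃ x : ι, u ∈ bag x ∧ v ∈ bag x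
  pathCondition : ∀ (x y z : ι) (p : T.Walk x y), p.IsPath → z ∈ p.support →
    bag x ∩ bag y ⊆ bag z

/-- The width of a tree decomposition: the size of its largest bag minus one. -/
noncomputable def TreeDecomp.width {V : Type} {G : SimpleGraph V} (d : TreeDecomp G) : ℕ :=
  (⨆ x : d.ι, (d.bag x).ncard) - 1

/-- The treewidth of `G`: the minimum width over all tree decompositions of `G`. -/
noncomputable def treewidth {V : Type} (G : SimpleGraph V) : ℕ :=
  sInf {w : ℕ | ∃ d : TreeDecomp G, d.width = w}

/-- The depth of a tree decomposition rooted at `r`: the maximum number of distinct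
vertices of `G` in the union of the bags along a path in `T` starting at the root `r`.
(Since bag unions only grow along extensions of a path, this agrees with the maximum
over root-to-leaf paths.) -/
noncomputable def TreeDecomp.depth {V : Type} {G : SimpleGraph V} (d : TreeDecomp G)
    (r : d.ι) : ℕ :=
  ⨆ x : d.ι, ⨆ p : d.T.Path r x, (⋃ z ∈ p.1.support, d.bag z).ncard

/-- The tree-depth of `G`: the minimum depth over all rooted tree decompositions of `G`. -/
noncomputable def treedepth {V : Type} (G : SimpleGraph V) : ℕ :=
  sInf {k : ℕ | ∃ (d : TreeDecomp G) (r : d.ι), d.depth r = k}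

namespace TDAux

/-- An elimination forest on `S`, given by the list of ancestors of each vertex. -/
def ElimForest {V : Type} (G : SimpleGraph V) (S : Finset V) (h : ℝ) : Prop :=
  ∃ L : V → List V, ∀ v ∈ S, (∃ t, L v = v :: t ∧ (t = [] ∨ ∃ u ∈ S, t = L u)) ∧
    (∀ u ∈ S, G.Adj u v → u ∈ L v ∨ v ∈ L u) ∧ ((L v).length : ℝ) ≤ h

lemma ElimForest.mono {V : Type} {G : SimpleGraph V} {S : Finset V} {h h' : ℝ}
    (H : ElimForest G S h) (hh : h ≤ h') : ElimForest G S h' := by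
  obtain ⟨L, hL⟩ := H
  exact ⟨L, fun v hv => ⟨(hL v hv).1, (hL v hv).2.1, (hL v hv).2.2.trans hh⟩⟩

open Classical in
lemma ElimForest.erase {V : Type} {G : SimpleGraph V} {S : Finset V} {h : ℝ} (h0 : 0 ≤ h)
    (a : V) (H : ElimForest G (S.erase a) h) : ElimForest G S (h + 1) := by
  by_cases ha : a ∈ S
  swap
  · rw [Finset.erase_eq_of_notMem ha] at H
    exact H.mono (by linarith)
  obtain ⟨L, hL⟩ := H
  refine ⟨fun v => if v = a then [a] else L v ++ [a], fun v hv => ?_⟩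
  by_cases hva : v = a
  · subst hva
    refine ⟨⟨[], by simp⟩, fun u hu huv => ?_, by simpa using h0⟩
    have : u ≠ v := huv.ne
    right; simp [this]
  · obtain ⟨⟨t, ht, ht'⟩, h2, h3⟩ := hL v (Finset.mem_erase.2 ⟨hva, hv⟩)
    refine ⟨⟨t ++ [a], by simp [hva, ht], Or.inr ?_⟩, fun u hu huv => ?_, ?_⟩
    · rcases ht' with rfl | ⟨u, hu, rfl⟩
      · exact ⟨a, ha, by simp⟩
      · rw [Finset.mem_erase] at hu
        exact ⟨u, hu.2, by simp [hu.1]⟩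
    · by_cases hua : u = a
      · subst hua
        left; simp [hva]
      · rcases h2 u (Finset.mem_erase.2 ⟨hua, hu⟩) huv with h | h
        · left; simp [hva, h]
        · right; simp [hua, h]
    · simp only [hva, if_false, List.length_append, List.length_singleton]
      push_cast
      linarith

open Classical in
lemma ElimForest.sdiff {V : Type} {G : SimpleGraph V} {h : ℝ} (h0 : 0 ≤ h)
    (B : Finset V) : ∀ S : Finset V, ElimForest G (S \ B) h → ElimForest G S (h + B.card) := by
  induction B using Finset.induction_on with
  | empty => intro S H; simpa using H
  | insert a B ha ih =>
    intro S H
    have h1 : S \ insert a B = (S.erase a) \ B := by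
      ext x; simp only [Finset.mem_sdiff, Finset.mem_insert, Finset.mem_erase]; tauto
    rw [h1] at H
    have h2 := ElimForest.erase (by positivity) a (ih _ H)
    rw [Finset.card_insert_of_notMem ha]
    refine h2.mono ?_
    push_cast
    linarith

open Classical in
lemma ElimForest.trivial {V : Type} {G : SimpleGraph V} (S : Finset V) :
    ElimForest G S (S.card : ℝ) := by
  have := ElimForest.sdiff (G := G) le_rfl S S ⟨fun _ => [], by simp⟩
  simpa using this

open Classical in
lemma ElimForest.split {V α : Type} {G : SimpleGraph V} {S : Finset V} {h : ℝ} (c : V → α)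
    (hc : ∀ u ∈ S, ∀ v ∈ S, G.Adj u v → c u = c v)
    (H : ∀ a, ElimForest G (S.filter (fun v => c v = a)) h) : ElimForest G S h := by
  choose L hL using H
  refine ⟨fun v => L (c v) v, fun v hv => ?_⟩
  obtain ⟨⟨t, ht, ht'⟩, h2, h3⟩ := hL (c v) v (Finset.mem_filter.2 ⟨hv, rfl⟩)
  refine ⟨⟨t, ht, ?_⟩, fun u hu huv => ?_, h3⟩
  · rcases ht' with rfl | ⟨u, hu, rfl⟩
    · exact Or.inl rfl
    · rw [Finset.mem_filter] at hu
      exact Or.inr ⟨u, hu.1, by simp only [hu.2]⟩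
  · have e := hc u hu v hv huv
    have := h2 u (Finset.mem_filter.2 ⟨hu, e⟩) huv
    simp only [e]
    exact this

/-- The graph of a parent function. -/
def parGraph {ι : Type} (p : ι → ι) : SimpleGraph ι := SimpleGraph.fromRel (fun a b => p a = b)

lemma parGraph_isTree {ι : Type} [Fintype ι] (p : ι → ι) (r : ι) (rk : ι → ℕ) (hr : p r = r)
    (hp : ∀ x, x ≠ r → rk (p x) < rk x) : (parGraph p).IsTree := by
  classical
  have hadj : ∀ x, x ≠ r → (parGraph p).Adj (p x) x := by
    intro x hx
    have : p x ≠ x := fun h => by have := hp x hx; rw [h] at this; omega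
    simp [parGraph, this]
  have hreach : ∀ n x, rk x ≤ n → (parGraph p).Reachable r x := by
    intro n
    induction n with
    | zero =>
      intro x hx
      by_cases h : x = r
      · subst h; exact SimpleGraph.Reachable.refl _
      · have := hp x h; omega
    | succ n ih =>
      intro x hx
      by_cases h : x = r
      · subst h; exact SimpleGraph.Reachable.refl _
      · have := hp x h
        exact (ih (p x) (by omega)).trans (hadj x h).reachable
  have hconn : (parGraph p).Connected := by
    haveI : Nonempty ι := ⟨r⟩
    exact ⟨fun x y => (hreach _ x le_rfl).symm.trans (hreach _ y le_rfl)⟩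
  rw [SimpleGraph.isTree_iff_connected_and_card]
  refine ⟨hconn, le_antisymm ?_ hconn.card_vert_le_card_edgeSet_add_one⟩
  have hsub : (parGraph p).edgeSet ⊆
      (((Finset.univ.erase r).image (fun x => s(x, p x)) : Finset (Sym2 ι)) : Set (Sym2 ι)) := by
    intro e
    induction e using Sym2.ind with
    | _ a b =>
      intro h
      simp only [SimpleGraph.mem_edgeSet, parGraph, SimpleGraph.fromRel_adj] at h
      simp only [Finset.coe_image, Set.mem_image, Finset.mem_coe, Finset.mem_erase,
        Finset.mem_univ, and_true]
      obtain ⟨hne, h | h⟩ := h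
      · refine ⟨a, ?_, by rw [h]⟩
        rintro rfl; exact hne (hr.symm.trans h)
      · refine ⟨b, ?_, by rw [h, Sym2.eq_swap]⟩
        rintro rfl; exact hne (h.symm.trans hr)
  have h1 := Set.ncard_le_ncard hsub (Finset.finite_toSet _)
  rw [Set.ncard_coe_finset] at h1
  have h2 : (Finset.univ.erase r).card + 1 = Fintype.card ι := by
    rw [Finset.card_erase_add_one (Finset.mem_univ r), Finset.card_univ]
  have h3 := Finset.card_image_le (s := Finset.univ.erase r) (f := fun x => s(x, p x))
  rw [Nat.card_eq_fintype_card (α := ι), Nat.card_coe_set_eq]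
  omega

lemma path_support_subset {ι : Type} {T : SimpleGraph ι} (hT : T.IsTree) {x y : ι}
    (p : T.Walk x y) (hp : p.IsPath) (q : T.Walk x y) : p.support ⊆ q.support := by
  classical
  have : (⟨p, hp⟩ : T.Path x y) = ⟨q.bypass, q.bypass_isPath⟩ := hT.IsAcyclic.path_unique _ _
  have h : p = q.bypass := congrArg Subtype.val this
  rw [h]
  exact q.support_bypass_subset_support

lemma treedepth_le {V : Type} [Fintype V] {G : SimpleGraph V} {h : ℝ}
    (H : ElimForest G Finset.univ h) (h0 : 0 ≤ h) : (treedepth G : ℝ) ≤ h := by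
  classical
  obtain ⟨L, hL⟩ := H
  let LL : Option V → List V := fun o => o.elim [] L
  let par : Option V → Option V := fun o => (LL o).tail.head?
  have hpar : ∀ o, LL (par o) = (LL o).tail := by
    rintro (_ | v)
    · rfl
    · obtain ⟨⟨t, ht, ht'⟩, -, -⟩ := hL v (Finset.mem_univ v)
      have e : (LL (some v)).tail = t := by simp [LL, ht]
      have e2 : par (some v) = t.head? := by simp only [par, e]
      rw [e, e2]
      rcases ht' with rfl | ⟨u, -, rfl⟩
      · rfl
      · obtain ⟨⟨t', ht', -⟩, -, -⟩ := hL u (Finset.mem_univ u)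
        simp only [ht', List.head?_cons]
        simp [LL, ht']
  have hlen : ∀ o, o ≠ none → (LL (par o)).length < (LL o).length := by
    rintro (_ | v) ho
    · exact absurd rfl ho
    · obtain ⟨⟨t, ht, ht'⟩, -, -⟩ := hL v (Finset.mem_univ v)
      rw [hpar]; simp [LL, ht]
  have htree : (parGraph par).IsTree := parGraph_isTree par none (fun o => (LL o).length) rfl hlen
  have hadj : ∀ x, x ≠ none → (parGraph par).Adj x (par x) := by
    intro x hx
    have : x ≠ par x := fun h => by have := hlen x hx; rw [← h] at this; omega
    simp [parGraph, this]
  have hwalk : ∀ v : V, ∀ n o, (LL o).length ≤ n → v ∈ LL o →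
      ∃ w : (parGraph par).Walk o (some v), ∀ z ∈ w.support, v ∈ LL z := by
    intro v n
    induction n with
    | zero =>
      intro o ho hv
      have : LL o = [] := List.length_eq_zero_iff.1 (by omega)
      simp [this] at hv
    | succ n ih =>
      rintro (_ | u) ho hv
      · simp [LL] at hv
      · by_cases huv : u = v
        · subst huv
          exact ⟨SimpleGraph.Walk.nil, by simpa using hv⟩
        · have hlt := hlen (some u) (by simp)
          obtain ⟨⟨t, ht, ht'⟩, -, -⟩ := hL u (Finset.mem_univ u)
          have hv' : v ∈ LL (par (some u)) := by
            rw [hpar]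
            simp only [LL, Option.elim, ht, List.mem_cons, List.tail_cons] at hv ⊢
            rcases hv with h | h
            · exact absurd h.symm huv
            · exact h
          obtain ⟨w, hw⟩ := ih _ (by omega) hv'
          refine ⟨SimpleGraph.Walk.cons (hadj _ (by simp)) w, ?_⟩
          intro z hz
          rw [SimpleGraph.Walk.support_cons, List.mem_cons] at hz
          rcases hz with rfl | hz
          · exact hv
          · exact hw z hz
  have hwalk2 : ∀ n o, (LL o).length ≤ n →
      ∃ w : (parGraph par).Walk o none, ∀ z ∈ w.support, LL z ⊆ LL o := by
    intro n
    induction n with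
    | zero =>
      rintro (_ | u) ho
      · exact ⟨SimpleGraph.Walk.nil, by simp⟩
      · have := hlen (some u) (by simp); omega
    | succ n ih =>
      rintro (_ | u) ho
      · exact ⟨SimpleGraph.Walk.nil, by simp⟩
      · have hlt := hlen (some u) (by simp)
        obtain ⟨w, hw⟩ := ih (par (some u)) (by omega)
        refine ⟨SimpleGraph.Walk.cons (hadj _ (by simp)) w, ?_⟩
        intro z hz
        rw [SimpleGraph.Walk.support_cons, List.mem_cons] at hz
        rcases hz with rfl | hz
        · exact List.Subset.refl _
        · have h5 := hw z hz
          rw [hpar] at h5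
          exact fun a ha => List.mem_of_mem_tail (h5 ha)
  have hself : ∀ v, v ∈ L v := by
    intro v
    obtain ⟨⟨t, ht, -⟩, -, -⟩ := hL v (Finset.mem_univ v)
    rw [ht]; simp
  let d : TreeDecomp G :=
    { ι := Option V
      fintype_ι := inferInstance
      T := parGraph par
      isTree := htree
      bag := fun o => {v | v ∈ LL o}
      vertexCover := fun v => ⟨some v, hself v⟩
      edgeCover := by
        intro u v huv
        rcases (hL v (Finset.mem_univ v)).2.1 u (Finset.mem_univ u) huv with h | h
        · exact ⟨some v, h, hself v⟩
        · exact ⟨some u, hself u, h⟩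
      pathCondition := by
        rintro x y z p hp hz v ⟨hvx, hvy⟩
        obtain ⟨w1, hw1⟩ := hwalk v _ x le_rfl hvx
        obtain ⟨w2, hw2⟩ := hwalk v _ y le_rfl hvy
        have := path_support_subset htree p hp (w1.append w2.reverse) hz
        rw [SimpleGraph.Walk.mem_support_append_iff, SimpleGraph.Walk.support_reverse,
          List.mem_reverse] at this
        rcases this with h | h
        · exact hw1 z h
        · exact hw2 z h }
  have hd : d.depth (none : Option V) ≤ ⌊h⌋₊ := by
    unfold TreeDecomp.depth
    haveI : Nonempty d.ι := ⟨(none : Option V)⟩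
    refine ciSup_le fun x => ?_
    haveI : Nonempty (d.T.Path (none : Option V) x) := by
      obtain ⟨w⟩ := d.isTree.connected.preconnected (none : Option V) x
      exact ⟨⟨w.bypass, w.bypass_isPath⟩⟩
    refine ciSup_le fun p => ?_
    have hsub : (⋃ z ∈ p.1.support, d.bag z) ⊆ (((LL x).toFinset : Finset V) : Set V) := by
      intro v hv
      simp only [Set.mem_iUnion] at hv
      obtain ⟨z, hz, hv⟩ := hv
      obtain ⟨w, hw⟩ := hwalk2 _ x le_rfl
      have := path_support_subset htree p.1 p.2 w.reverse hz
      rw [SimpleGraph.Walk.support_reverse, List.mem_reverse] at this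
      have := hw z this hv
      simpa using this
    have h1 := Set.ncard_le_ncard hsub (Finset.finite_toSet _)
    rw [Set.ncard_coe_finset] at h1
    refine (h1.trans (List.toFinset_card_le _)).trans (Nat.le_floor ?_)
    cases x with
    | none => simpa [LL] using h0
    | some v => exact (hL v (Finset.mem_univ v)).2.2
  have ht : treedepth G ≤ d.depth (none : Option V) := Nat.sInf_le ⟨d, _, rfl⟩
  exact (Nat.cast_le.2 (ht.trans hd)).trans (Nat.floor_le h0)

/-- `y` and `z` are joined by a walk avoiding `x`. -/
def Avoid {ι : Type} (T : SimpleGraph ι) (x y z : ι) : Prop :=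
  ∃ w : T.Walk y z, x ∉ w.support

lemma Avoid.symm {ι : Type} {T : SimpleGraph ι} {x y z : ι} (h : Avoid T x y z) :
    Avoid T x z y := by
  obtain ⟨w, hw⟩ := h
  exact ⟨w.reverse, by simpa using hw⟩

lemma Avoid.trans {ι : Type} {T : SimpleGraph ι} {x y z u : ι} (h : Avoid T x y z)
    (h' : Avoid T x z u) : Avoid T x y u := by
  obtain ⟨w, hw⟩ := h
  obtain ⟨w', hw'⟩ := h'
  refine ⟨w.append w', ?_⟩
  rw [SimpleGraph.Walk.mem_support_append_iff]
  tauto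

lemma exists_branch {ι : Type} {T : SimpleGraph ι} (hT : T.IsTree) {x z : ι} (hxz : z ≠ x) :
    ∃ y, T.Adj x y ∧ Avoid T x y z := by
  classical
  obtain ⟨w⟩ := hT.connected.preconnected x z
  have hp := w.bypass_isPath
  cases h : w.bypass with
  | nil => exact absurd rfl hxz
  | cons ha q =>
    rw [h, SimpleGraph.Walk.cons_isPath_iff] at hp
    exact ⟨_, ha, q, hp.2⟩

lemma branch_unique {ι : Type} {T : SimpleGraph ι} (hT : T.IsTree) {x y y' : ι}
    (h : T.Adj x y) (h' : T.Adj x y') (H : Avoid T x y y') : y = y' := by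
  classical
  obtain ⟨w, hw⟩ := H
  have hw' : x ∉ w.bypass.support := fun h => hw (w.support_bypass_subset_support h)
  have h1 : (SimpleGraph.Walk.cons h w.bypass).IsPath :=
    (SimpleGraph.Walk.cons_isPath_iff _ _).2 ⟨w.bypass_isPath, hw'⟩
  have h2 := path_support_subset hT _ h1 (SimpleGraph.Walk.cons h' SimpleGraph.Walk.nil)
  have h3 := @h2 y (by simp)
  simp only [SimpleGraph.Walk.support_cons, SimpleGraph.Walk.support_nil, List.mem_cons,
    List.not_mem_nil, or_false] at h3
  rcases h3 with h3 | h3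
  · exact absurd h3.symm h.ne
  · exact h3

lemma avoid_disjoint {ι : Type} {T : SimpleGraph ι} (hT : T.IsTree) {x y z : ι}
    (h : T.Adj x y) (H : Avoid T x y z) (H' : Avoid T y x z) : False := by
  classical
  obtain ⟨w, hw⟩ := H
  obtain ⟨w', hw'⟩ := H'
  have hw1 : x ∉ w.bypass.support := fun h => hw (w.support_bypass_subset_support h)
  have h1 : (SimpleGraph.Walk.cons h w.bypass).IsPath :=
    (SimpleGraph.Walk.cons_isPath_iff _ _).2 ⟨w.bypass_isPath, hw1⟩
  exact hw' (path_support_subset hT _ h1 w' (by simp))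

/-- In a finite tree, a choice of neighbour at every node picks some edge twice. -/
lemma exists_mutual {ι : Type} [Fintype ι] {T : SimpleGraph ι} (hT : T.IsTree) (g : ι → ι)
    (hg : ∀ x, T.Adj x (g x)) : ∃ x, g (g x) = x := by
  classical
  have hc := hT.card_edgeFinset
  obtain ⟨x, -, y, -, hne, he⟩ := Finset.exists_ne_map_eq_of_card_lt_of_maps_to
    (s := Finset.univ) (t := T.edgeFinset) (f := fun x => s(x, g x))
    (by rw [Finset.card_univ]; omega) (by intro x _; simpa using hg x)
  simp only [Sym2.eq_iff] at he
  rcases he with he | he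
  · exact absurd he.1 hne
  · exact ⟨x, by rw [he.2, ← he.1]⟩

open Classical in
lemma exists_separator {V : Type} {G : SimpleGraph V} (d : TreeDecomp G) (W : Finset V) :
    ∃ (x : d.ι) (c : V → d.ι),
      (∀ u v, u ∉ d.bag x → v ∉ d.bag x → G.Adj u v → c u = c v) ∧
      ∀ y, 2 * (W.filter (fun w => w ∉ d.bag x ∧ c w = y)).card ≤ W.card := by
  letI := d.fintype_ι
  have hc : ∀ (x : d.ι) (v : V), ∃ y, v ∉ d.bag x →
      d.T.Adj x y ∧ ∀ z, v ∈ d.bag z → Avoid d.T x y z := by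
    intro x v
    by_cases hv : v ∈ d.bag x
    · exact ⟨x, fun h => absurd hv h⟩
    obtain ⟨z, hz⟩ := d.vertexCover v
    have hzx : z ≠ x := by rintro rfl; exact hv hz
    obtain ⟨y, hy, hyz⟩ := exists_branch d.isTree hzx
    refine ⟨y, fun _ => ⟨hy, fun z' hz' => hyz.trans ?_⟩⟩
    obtain ⟨w⟩ := d.isTree.connected.preconnected z z'
    exact ⟨w.bypass, fun hx => hv (d.pathCondition z z' x _ w.bypass_isPath hx ⟨hz, hz'⟩)⟩
  choose c hc using hc
  by_contra! hcon
  have hcc : ∀ x, ∃ y, W.card < 2 * (W.filter (fun w => w ∉ d.bag x ∧ c x w = y)).card := by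
    intro x
    refine hcon x (c x) ?_
    intro u v hu hv huv
    obtain ⟨z, hzu, hzv⟩ := d.edgeCover u v huv
    obtain ⟨h1, h2⟩ := hc x u hu
    obtain ⟨h3, h4⟩ := hc x v hv
    exact branch_unique d.isTree h1 h3 ((h2 z hzu).trans (h4 z hzv).symm)
  choose g hg using hcc
  have hadj : ∀ x, d.T.Adj x (g x) := by
    intro x
    have : (W.filter (fun w => w ∉ d.bag x ∧ c x w = g x)).Nonempty := by
      rw [← Finset.card_pos]
      have := hg x
      omega
    obtain ⟨w, hw⟩ := this
    rw [Finset.mem_filter] at hw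
    rw [← hw.2.2]
    exact (hc x w hw.2.1).1
  obtain ⟨x, hx⟩ := exists_mutual d.isTree g hadj
  have hdis : Disjoint (W.filter (fun w => w ∉ d.bag x ∧ c x w = g x))
      (W.filter (fun w => w ∉ d.bag (g x) ∧ c (g x) w = g (g x))) := by
    rw [Finset.disjoint_left]
    intro w h1 h2
    rw [Finset.mem_filter] at h1 h2
    obtain ⟨z, hz⟩ := d.vertexCover w
    have a1 := (hc x w h1.2.1).2 z hz
    have a2 := (hc (g x) w h2.2.1).2 z hz
    rw [h1.2.2] at a1
    rw [h2.2.2, hx] at a2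
    exact avoid_disjoint d.isTree (hadj x) a1 a2
  have hu := Finset.card_union_of_disjoint hdis
  have hle : (W.filter (fun w => w ∉ d.bag x ∧ c x w = g x) ∪
      W.filter (fun w => w ∉ d.bag (g x) ∧ c (g x) w = g (g x))).card ≤ W.card :=
    Finset.card_le_card
      (Finset.union_subset (Finset.filter_subset _ _) (Finset.filter_subset _ _))
  have := hg x
  have := hg (g x)
  omega

lemma logb_three : (3 : ℝ) / 2 ≤ Real.logb 2 3 := by
  rw [Real.le_logb_iff_rpow_le (by norm_num) (by norm_num)]
  have h : ((2 : ℝ) ^ ((3 : ℝ) / 2)) ^ 2 = 8 := by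
    rw [← Real.rpow_natCast, ← Real.rpow_mul (by norm_num)]
    norm_num
  nlinarith [Real.rpow_nonneg (by norm_num : (0 : ℝ) ≤ 2) ((3 : ℝ) / 2)]

lemma main_rec {V : Type} [Fintype V] {G : SimpleGraph V} (d : TreeDecomp G) (k : ℕ)
    (hk : 2 ≤ k) (hd : ∀ x, (d.bag x).ncard ≤ k) : ∀ m : ℕ, 2 ≤ m → ∀ W : Finset V,
      W.card ≤ m → ElimForest G W (k * Real.logb 2 m) := by
  classical
  have hk' : (2 : ℝ) ≤ k := by exact_mod_cast hk
  intro m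
  induction m using Nat.strong_induction_on with
  | _ m ih =>
    intro hm W hW
    by_cases hm4 : m < 4
    · refine (ElimForest.trivial W).mono ?_
      have hW' : (W.card : ℝ) ≤ m := by exact_mod_cast hW
      refine hW'.trans ?_
      obtain rfl | rfl : m = 2 ∨ m = 3 := by omega
      · simpa using hk'
      · have := logb_three
        push_cast
        nlinarith
    · obtain ⟨x, c, h1, h2⟩ := exists_separator d W
      have hm2 : 2 ≤ m / 2 := by omega
      have hlog : Real.logb 2 ((m / 2 : ℕ) : ℝ) + 1 ≤ Real.logb 2 m := by
        have hpos : (0 : ℝ) < ((m / 2 : ℕ) : ℝ) := by exact_mod_cast (by omega : 0 < m / 2)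
        have e : Real.logb 2 ((m / 2 : ℕ) : ℝ) + 1 = Real.logb 2 (((m / 2 : ℕ) : ℝ) * 2) := by
          rw [Real.logb_mul hpos.ne' (by norm_num)]
          simp
        rw [e]
        refine Real.logb_le_logb_of_le (by norm_num) (by positivity) ?_
        exact_mod_cast Nat.div_mul_le_self m 2
      have hnn : 0 ≤ Real.logb 2 ((m / 2 : ℕ) : ℝ) :=
        Real.logb_nonneg (by norm_num) (by exact_mod_cast (by omega : 1 ≤ m / 2))
      have hs : ElimForest G (W \ (d.bag x).toFinset) (k * Real.logb 2 ((m / 2 : ℕ) : ℝ)) := by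
        refine ElimForest.split c ?_ ?_
        · intro u hu v hv huv
          simp only [Finset.mem_sdiff, Set.mem_toFinset] at hu hv
          exact h1 u v hu.2 hv.2 huv
        · intro y
          refine ih _ (by omega) hm2 _ ?_
          have := h2 y
          have e : (W \ (d.bag x).toFinset).filter (fun v => c v = y)
              = W.filter (fun w => w ∉ d.bag x ∧ c w = y) := by
            ext v
            simp only [Finset.mem_filter, Finset.mem_sdiff, Set.mem_toFinset]
            tauto
          rw [e]
          omega
      refine (ElimForest.sdiff (by positivity) _ _ hs).mono ?_
      have hb : (((d.bag x).toFinset.card : ℕ) : ℝ) ≤ k := by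
        have := hd x
        rw [Set.ncard_eq_toFinset_card'] at this
        exact_mod_cast this
      nlinarith

lemma bddAbove_bag {V : Type} [Fintype V] {G : SimpleGraph V} (d : TreeDecomp G) :
    BddAbove (Set.range fun x : d.ι => (d.bag x).ncard) := by
  letI := d.fintype_ι
  exact Set.Finite.bddAbove (Set.finite_range _)

/-- The decomposition with a single bag. -/
def trivialDecomp {V : Type} (G : SimpleGraph V) : TreeDecomp G where
  ι := Unit
  fintype_ι := inferInstance
  T := ⊥
  isTree := by
    rw [SimpleGraph.isTree_iff_connected_and_card]
    exact ⟨⟨fun _ _ => SimpleGraph.Reachable.refl _⟩, by simp⟩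
  bag := fun _ => Set.univ
  vertexCover := fun _ => ⟨(), trivial⟩
  edgeCover := fun _ _ _ => ⟨(), trivial, trivial⟩
  pathCondition := fun _ _ _ _ _ _ _ _ => trivial

lemma bag_le_depth {V : Type} [Fintype V] {G : SimpleGraph V} (d : TreeDecomp G) (r x : d.ι) :
    (d.bag x).ncard ≤ d.depth r := by
  classical
  letI := d.fintype_ι
  have hb : ∀ s : Set V, s.ncard ≤ Fintype.card V := fun s => by
    rw [← Nat.card_eq_fintype_card, ← Set.ncard_univ]
    exact Set.ncard_le_ncard (Set.subset_univ _)
  obtain ⟨w⟩ := d.isTree.connected.preconnected r x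
  let p : d.T.Path r x := ⟨w.bypass, w.bypass_isPath⟩
  unfold TreeDecomp.depth
  refine le_trans ?_ (le_ciSup (Set.finite_range _).bddAbove x)
  have : BddAbove (Set.range fun p : d.T.Path r x => (⋃ z ∈ p.1.support, d.bag z).ncard) :=
    ⟨Fintype.card V, by rintro _ ⟨p, rfl⟩; exact hb _⟩
  refine le_trans ?_ (le_ciSup this p)
  refine Set.ncard_le_ncard ?_
  intro v hv
  simp only [Set.mem_iUnion]
  exact ⟨x, SimpleGraph.Walk.end_mem_support _, hv⟩

end TDAux

/-- For any connected graph `G` on `n ≥ 2` vertices,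
`td(G) ≥ tw(G) + 1 ≥ td(G) / log₂ n`. -/
theorem treewidth_le_treedepth_le {V : Type} [Fintype V] (G : SimpleGraph V)
    (hG : G.Connected) (n : ℕ) (hn : Fintype.card V = n) (h2 : 2 ≤ n) :
    treewidth G + 1 ≤ treedepth G ∧
      (treedepth G : ℝ) / Real.logb 2 (n : ℝ) ≤ (treewidth G : ℝ) + 1 := by
  classical
  subst hn
  haveI : Nontrivial V := Fintype.one_lt_card_iff_nontrivial.1 h2
  have hwidth : ∀ d : TreeDecomp G, (⨆ x : d.ι, (d.bag x).ncard) = d.width + 1 ∧ 1 ≤ d.width := by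
    intro d
    obtain ⟨u⟩ := hG.nonempty
    obtain ⟨v, huv⟩ := hG.preconnected.exists_adj_of_nontrivial u
    obtain ⟨x, hu, hv⟩ := d.edgeCover u v huv
    have h1 : 1 < (d.bag x).ncard :=
      (Set.one_lt_ncard (Set.toFinite _)).2 ⟨u, hu, v, hv, huv.ne⟩
    have h3 := le_ciSup (TDAux.bddAbove_bag d) x
    unfold TreeDecomp.width
    omega
  constructor
  · have hne : {k : ℕ | ∃ (d : TreeDecomp G) (r : d.ι), d.depth r = k}.Nonempty :=
      ⟨_, TDAux.trivialDecomp G, (), rfl⟩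
    obtain ⟨d, r, hdr⟩ := Nat.sInf_mem hne
    have h1 : treewidth G ≤ d.width := Nat.sInf_le ⟨d, rfl⟩
    have h3 : (⨆ x : d.ι, (d.bag x).ncard) ≤ d.depth r := by
      haveI : Nonempty d.ι := ⟨r⟩
      exact ciSup_le (TDAux.bag_le_depth d r)
    have h4 := (hwidth d).1
    change treewidth G + 1 ≤ sInf _
    rw [← hdr]
    omega
  · have hne : {w : ℕ | ∃ d : TreeDecomp G, d.width = w}.Nonempty :=
      ⟨_, TDAux.trivialDecomp G, rfl⟩
    obtain ⟨d, hd⟩ := Nat.sInf_mem hne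
    change d.width = treewidth G at hd
    obtain ⟨h1, h3⟩ := hwidth d
    have hbag : ∀ x, (d.bag x).ncard ≤ treewidth G + 1 := fun x => by
      rw [← hd, ← h1]
      exact le_ciSup (TDAux.bddAbove_bag d) x
    have hE := TDAux.main_rec d (treewidth G + 1) (by omega) hbag (Fintype.card V) h2
      Finset.univ le_rfl
    have hlog : 0 < Real.logb 2 (Fintype.card V : ℝ) :=
      Real.logb_pos (by norm_num) (by exact_mod_cast h2)
    rw [div_le_iff₀ hlog]
    have := TDAux.treedepth_le hE (by positivity)
    push_cast at this
    exact this
end
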